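/- Let α be a closed confluent continuous partial action on a normal topological space X of covering dimension n. Then the globalization Y is normal and dim(Y) = n. -/

import Mathlib

/-- One-step reduction on words over `G` induced by the rules `R` of a monoid
presentation `⟨G|R⟩`. -/
def MStep {G : Type*} (R : List G → List G → Prop) : List G → List G → Prop :=
  fun w₁ w₂ => ∃ a l r b : List G, R l r ∧ w₁ = a ++ l ++ b ∧ w₂ = a ++ r ++ b

/-- One-step reduction on `G* × X` for a confluent partial action: either
rewrite the word via `R`, or let the last (rightmost, acting first) generator
act on the point. -/
def PStep {G X : Type*} (R : List G → List G → Prop) (act : G → X → Option X) :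
    List G × X → List G × X → Prop := fun p q =>
  (MStep R p.1 q.1 ∧ p.2 = q.2) ∨
  (∃ (w : List G) (g : G) (y : X),
    p.1 = w ++ [g] ∧ act g p.2 = some y ∧ q.1 = w ∧ q.2 = y)

/-- The globalization `Y` of a confluent partial action: the quotient of
`G* × X` by the equivalence generated by the one-step reduction `PStep`. -/
def PGlob {G X : Type*} (R : List G → List G → Prop) (act : G → X → Option X) : Type _ :=
  Quot (Relation.EqvGen (PStep R act))

/-- The class of `(w, x)` in the globalization. -/
def PGlob.mk {G X : Type*} (R : List G → List G → Prop) (act : G → X → Option X)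
    (p : List G × X) : PGlob R act :=
  Quot.mk _ p

/-- The topological globalization: the final topology with respect to all the
maps `x ↦ [w, x]`, `w` a word over `G`. -/
instance {G X : Type*} (R : List G → List G → Prop) (act : G → X → Option X)
    [t : TopologicalSpace X] : TopologicalSpace (PGlob R act) :=
  ⨆ w : List G, TopologicalSpace.coinduced (fun x : X => PGlob.mk R act (w, x)) t

/-- Covering dimension `≤ n`: every finite open cover has an open shrinking of
order at most `n + 1` (each point lies in at most `n + 1` members). -/
def CovDimLE (A : Type*) [TopologicalSpace A] (n : ℕ) : Prop :=
  ∀ (ι : Type) (_ : Finite ι) (U : ι → Set A), (∀ i, IsOpen (U i)) →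
    (⋃ i, U i) = Set.univ →
    ∃ V : ι → Set A, (∀ i, IsOpen (V i)) ∧ (∀ i, V i ⊆ U i) ∧
      (⋃ i, V i) = Set.univ ∧ ∀ a : A, {i | a ∈ V i}.ncard ≤ n + 1

open Set Relation

section Extension

/-- Two compatible continuous real functions on closed subsets of a normal space have a common
continuous extension. -/
theorem exists_continuous_eqOn_eqOn {X : Type*} [TopologicalSpace X] [NormalSpace X]
    {D E : Set X} (hD : IsClosed D) (hE : IsClosed E) {f g : X → ℝ}
    (hf : ContinuousOn f D) (hg : ContinuousOn g E) (hfg : ∀ x ∈ D, x ∈ E → f x = g x) :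
    ∃ h : X → ℝ, Continuous h ∧ EqOn h f D ∧ EqOn h g E := by
  classical
  have hf' : EqOn (D.piecewise f g) f D := D.piecewise_eqOn f g
  have hg' : EqOn (D.piecewise f g) g E := by
    intro x hx
    by_cases hxD : x ∈ D
    · rw [piecewise_eq_of_mem _ _ _ hxD, hfg x hxD hx]
    · rw [piecewise_eq_of_notMem _ _ _ hxD]
  have hcont : ContinuousOn (D.piecewise f g) (D ∪ E) :=
    (hf.congr hf').union_of_isClosed (hg.congr hg') hD hE
  obtain ⟨h, hh⟩ := ContinuousMap.exists_restrict_eq (hD.union hE)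
    ⟨(D ∪ E).domRestrict (D.piecewise f g), hcont.domRestrict⟩
  have key : EqOn h (D.piecewise f g) (D ∪ E) := fun x hx => congr($hh ⟨x, hx⟩)
  exact ⟨h, h.continuous, fun x hx => (key (Or.inl hx)).trans (hf' hx),
    fun x hx => (key (Or.inr hx)).trans (hg' hx)⟩

/-- The cone over the `n`-skeleton of the simplex with vertices `ι`: nonnegative tuples with at
most `n + 1` nonzero entries. -/
def skeletonCone (ι : Type*) (n : ℕ) : Set (ι → ℝ) :=
  {t | (∀ i, 0 ≤ t i) ∧ {i | t i ≠ 0}.ncard ≤ n + 1}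

/-- The nonnegative orthant retracts onto `skeletonCone ι n`, without enlarging supports. -/
theorem exists_retraction_skeletonCone (ι : Type*) [Finite ι] (n : ℕ) :
    ∃ r : (ι → ℝ) → ι → ℝ, Continuous r ∧ (∀ t, (∀ i, 0 ≤ t i) → r t ∈ skeletonCone ι n) ∧
      (∀ t, (∀ i, 0 ≤ t i) → ∀ i, r t i ≠ 0 → t i ≠ 0) ∧ ∀ t ∈ skeletonCone ι n, r t = t := by
  classical
  have := Fintype.ofFinite ι
  let low : Finset ι → (ι → ℝ) → ℝ := fun J t => if h : J.Nonempty then J.inf' h t else 0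
  have low_cont : ∀ J, Continuous (low J) := by
    intro J
    by_cases h : J.Nonempty
    · simp only [low, h, dite_true]
      exact Continuous.finset_inf'_apply h fun i _ => continuous_apply i
    · simp only [low, h, dite_false]
      exact continuous_const
  have low_nonneg : ∀ J (t : ι → ℝ), (∀ i, 0 ≤ t i) → 0 ≤ low J t := by
    intro J t ht
    by_cases h : J.Nonempty
    · simp only [low, h, dite_true]
      exact Finset.le_inf' _ _ fun i _ => ht i
    · simp [low, h]
  let s : (ι → ℝ) → ℝ := fun t => ∑ J ∈ Finset.univ.powersetCard (n + 2), low J t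
  have s_nonneg : ∀ t : ι → ℝ, (∀ i, 0 ≤ t i) → 0 ≤ s t := fun t ht =>
    Finset.sum_nonneg fun J _ => low_nonneg J t ht
  refine ⟨fun t i => max (t i - s t) 0, ?_, ?_, ?_, ?_⟩
  · have : Continuous s := continuous_finsetSum _ fun J _ => low_cont J
    fun_prop
  · refine fun t ht => ⟨fun i => le_max_right _ _, ?_⟩
    by_contra hcard
    rw [ncard_eq_toFinset_card'] at hcard
    obtain ⟨J, hJ, hJcard⟩ := Finset.exists_subset_card_eq (n := n + 2) (by lia :
      n + 2 ≤ (Set.toFinset {i | max (t i - s t) 0 ≠ 0}).card)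
    have hne : J.Nonempty := Finset.card_pos.1 (by lia)
    have hle : low J t ≤ s t := Finset.single_le_sum (f := fun J => low J t)
      (fun J _ => low_nonneg J t ht) (Finset.mem_powersetCard.2 ⟨Finset.subset_univ _, hJcard⟩)
    obtain ⟨j, hj, hjeq⟩ := Finset.exists_mem_eq_inf' hne t
    have hlow : low J t = t j := by simp only [low, hne, dite_true, hjeq]
    have := hJ hj
    simp only [mem_toFinset, mem_ofPred_eq] at this
    exact this (max_eq_right (by linarith))
  · intro t ht i hi hti
    apply hi
    simp [hti, s_nonneg t ht]
  · intro t ht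
    have hs : s t = 0 := by
      refine Finset.sum_eq_zero fun J hJ => ?_
      have hJcard := (Finset.mem_powersetCard.1 hJ).2
      have hne : J.Nonempty := Finset.card_pos.1 (by lia)
      have : ∃ j ∈ J, t j = 0 := by
        by_contra! hJt
        have h1 := ncard_le_ncard (s := (J : Set ι)) (t := {i | t i ≠ 0}) hJt (toFinite _)
        rw [ncard_coe_finset] at h1
        have := ht.2
        lia
      obtain ⟨j, hj, hj0⟩ := this
      refine le_antisymm ?_ (low_nonneg J t ht.1)
      simp only [low, hne, dite_true]
      exact (Finset.inf'_le _ hj).trans hj0.le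
    funext i
    simp [hs, ht.1 i]

/-- A family of nonnegative functions without common zero, at most `n + 1` of them nonzero at each
point, and subordinate to a finite open cover of a normal space of covering dimension at most `n`,
extends from closed subsets. -/
theorem CovDimLE.exists_extension {X : Type*} [TopologicalSpace X] [NormalSpace X] {n : ℕ}
    (hdim : CovDimLE X n) {ι : Type} [Finite ι] {U : ι → Set X} (hU : ∀ i, IsOpen (U i))
    (hcov : ⋃ i, U i = univ) {D : Set X} (hD : IsClosed D) {f : X → ι → ℝ}
    (hf : ContinuousOn f D)
    (hfD : ∀ x ∈ D, f x ∈ skeletonCone ι n ∧ f x ≠ 0 ∧ ∀ i, f x i ≠ 0 → x ∈ U i) :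
    ∃ h : X → ι → ℝ, Continuous h ∧ EqOn h f D ∧
      ∀ x, h x ∈ skeletonCone ι n ∧ h x ≠ 0 ∧ ∀ i, h x i ≠ 0 → x ∈ U i := by
  classical
  obtain ⟨r, hr, hrmem, hrsupp, hrfix⟩ := exists_retraction_skeletonCone ι n
  have hext : ∀ i, ∃ e : X → ℝ, Continuous e ∧ EqOn e (fun x => f x i) D ∧
      EqOn e (fun _ => 0) (U i)ᶜ := fun i =>
    exists_continuous_eqOn_eqOn hD (hU i).isClosed_compl (continuousOn_pi.1 hf i)
      continuousOn_const fun x hxD hxU => by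
        by_contra h
        exact hxU ((hfD x hxD).2.2 i h)
  choose e he heD heU using hext
  let F : X → ι → ℝ := fun x => r fun i => max (e i x) 0
  have hF : Continuous F := by
    refine hr.comp (continuous_pi fun i => ?_)
    exact (he i).max continuous_const
  have hFmem : ∀ x, F x ∈ skeletonCone ι n := fun x => hrmem _ fun i => le_max_right _ _
  have hFD : EqOn F f D := by
    intro x hx
    have : (fun i => max (e i x) 0) = f x := by
      funext i
      rw [heD i hx]
      exact max_eq_left ((hfD x hx).1.1 i)
    simp only [F, this]
    exact hrfix _ (hfD x hx).1
  have hFU : ∀ x i, F x i ≠ 0 → x ∈ U i := by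
    intro x i hi
    by_contra hxU
    refine hrsupp _ (fun i => le_max_right _ _) i hi ?_
    simp [heU i hxU]
  have hO : IsOpen {x | F x ≠ 0} := isOpen_ne_fun hF continuous_const
  have hDO : D ⊆ {x | F x ≠ 0} := fun x hx => by
    rw [mem_ofPred_eq, hFD hx]
    exact (hfD x hx).2.1
  obtain ⟨N, hN, hDN, hNO⟩ := normal_exists_closure_subset hD hO hDO
  let W : ι × Bool → Set X := fun p => cond p.2 {x | F x p.1 ≠ 0} (U p.1 \ closure N)
  obtain ⟨V, hV, hVW, hVcov, hVord⟩ := hdim (ι × Bool) inferInstance W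
    (by
      rintro ⟨i, b | b⟩
      · exact (hU i).sdiff isClosed_closure
      · exact isOpen_ne_fun ((continuous_apply i).comp hF) continuous_const)
    (by
      refine eq_univ_of_forall fun x => mem_iUnion.2 ?_
      by_cases hx : x ∈ closure N
      · obtain ⟨i, hi⟩ := Function.ne_iff.1 (hNO hx)
        exact ⟨(i, true), hi⟩
      · obtain ⟨i, hi⟩ := mem_iUnion.1 (hcov ▸ mem_univ x)
        exact ⟨(i, false), hi, hx⟩)
  have hV' : ∀ i, IsOpen (V (i, true) ∪ V (i, false)) := fun i => (hV _).union (hV _)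
  obtain ⟨φ, hφ⟩ := PartitionOfUnity.exists_isSubordinate_of_locallyFinite isClosed_univ
    (fun i => V (i, true) ∪ V (i, false)) hV' (locallyFinite_of_finite _) (by
      intro x _
      obtain ⟨⟨i, b⟩, hi⟩ := mem_iUnion.1 (hVcov ▸ mem_univ x)
      refine mem_iUnion.2 ⟨i, ?_⟩
      cases b
      exacts [Or.inr hi, Or.inl hi])
  have hφV : ∀ x i, φ i x ≠ 0 → x ∈ V (i, true) ∪ V (i, false) := fun x i hi =>
    hφ i (subset_tsupport _ hi)
  have hφU : ∀ x i, φ i x ≠ 0 → x ∈ U i := by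
    intro x i hi
    rcases hφV x i hi with h | h
    · exact hFU x i (hVW _ h)
    · exact (hVW _ h).1
  have hφF : ∀ x ∈ closure N, ∀ i, φ i x ≠ 0 → F x i ≠ 0 := by
    intro x hx i hi
    rcases hφV x i hi with h | h
    · exact hVW _ h
    · exact absurd hx (hVW _ h).2
  have hφord : ∀ x, {i | φ i x ≠ 0}.ncard ≤ n + 1 := by
    intro x
    refine le_trans ?_ (hVord x)
    have hsub : {i | φ i x ≠ 0} ⊆ Prod.fst '' {p | x ∈ V p} := by
      intro i hi
      rcases hφV x i hi with h | h
      exacts [⟨_, h, rfl⟩, ⟨_, h, rfl⟩]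
    exact (ncard_le_ncard hsub (toFinite _)).trans (ncard_image_le (toFinite _))
  obtain ⟨l, hlD, hlN, hl⟩ := exists_continuous_zero_one_of_isClosed hD hN.isClosed_compl
    (disjoint_compl_right_iff_subset.2 hDN)
  have hnn1 : ∀ x i, 0 ≤ (1 - l x) * F x i := fun x i =>
    mul_nonneg (by linarith [(hl x).2]) ((hFmem x).1 i)
  have hnn2 : ∀ x i, 0 ≤ l x * φ i x := fun x i => mul_nonneg (hl x).1 (φ.nonneg i x)
  have hsupp : ∀ x i, (1 - l x) * F x i + l x * φ i x ≠ 0 → F x i ≠ 0 ∨ φ i x ≠ 0 := by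
    intro x i h
    by_contra! hc
    simp [hc.1, hc.2] at h
  refine ⟨fun x i => (1 - l x) * F x i + l x * φ i x, ?_, ?_, fun x => ⟨⟨?_, ?_⟩, ?_, ?_⟩⟩
  · refine continuous_pi fun i => ?_
    have h1 : Continuous fun x => F x i := (continuous_apply i).comp hF
    have h2 := (φ i).continuous
    have h3 := l.continuous
    fun_prop
  · intro x hx
    funext i
    simp [hlD hx, hFD hx]
  · exact fun i => add_nonneg (hnn1 x i) (hnn2 x i)
  · by_cases hx : x ∈ closure N
    · refine (ncard_le_ncard (fun i hi => ?_) (toFinite _)).trans (hFmem x).2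
      exact (hsupp x i hi).elim id (hφF x hx i)
    · refine (ncard_le_ncard (fun i hi => ?_) (toFinite _)).trans (hφord x)
      have h1 : l x = 1 := hlN fun h => hx (subset_closure h)
      simpa [h1] using hi
  · intro h0
    have hz : ∀ i, (1 - l x) * F x i = 0 ∧ l x * φ i x = 0 := fun i =>
      (add_eq_zero_iff_of_nonneg (hnn1 x i) (hnn2 x i)).1 (congrFun h0 i)
    obtain ⟨i, hi⟩ := φ.exists_pos (mem_univ x)
    have hl0 : l x = 0 := (mul_eq_zero.1 (hz i).2).resolve_right hi.ne'
    have hxN : x ∈ N := by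
      by_contra hxN
      have : l x = 1 := hlN hxN
      simp [hl0] at this
    obtain ⟨j, hj⟩ := Function.ne_iff.1 (hNO (subset_closure hxN))
    exact hj (by simpa [hl0] using (hz j).1)
  · exact fun i hi => (hsupp x i hi).elim (hFU x i) (hφU x i)

end Extension

section Globalization

variable {G X : Type*} {R : List G → List G → Prop} {act : G → X → Option X}

theorem PGlob.mk_eq_of_eqvGen {p q : List G × X} (h : EqvGen (PStep R act) p q) :
    PGlob.mk R act p = PGlob.mk R act q :=
  Quot.sound h

theorem PGlob.mk_append_singleton (w : List G) {g : G} {x y : X} (h : act g x = some y) :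
    PGlob.mk R act (w ++ [g], x) = PGlob.mk R act (w, y) :=
  mk_eq_of_eqvGen (.rel _ _ (Or.inr ⟨w, g, y, rfl, h, rfl, rfl⟩))

theorem PGlob.mk_eq_of_reflTransGen_mStep {w u : List G} (h : ReflTransGen (MStep R) w u)
    (x : X) : PGlob.mk R act (w, x) = PGlob.mk R act (u, x) := by
  induction h with
  | refl => rfl
  | tail _ hs ih => exact ih.trans (mk_eq_of_eqvGen (.rel _ _ (Or.inl ⟨hs, rfl⟩)))

/-- **Church–Rosser property** for the globalization. -/
theorem PGlob.join_of_mk_eq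
    (hconfP : ∀ p q₁ q₂ : List G × X, ReflTransGen (PStep R act) p q₁ →
      ReflTransGen (PStep R act) p q₂ →
      ∃ t, ReflTransGen (PStep R act) q₁ t ∧ ReflTransGen (PStep R act) q₂ t)
    {p q : List G × X} (h : PGlob.mk R act p = PGlob.mk R act q) :
    ∃ t, ReflTransGen (PStep R act) p t ∧ ReflTransGen (PStep R act) q t := by
  have h1 : EqvGen (PStep R act) p q :=
    (EqvGen.is_equivalence _).eqvGen_iff.1 (Quot.eqvGen_exact h)
  have he : Equivalence (Join (ReflTransGen (PStep R act))) := equivalence_join hconfP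
  exact he.eqvGen_iff.1 (h1.mono fun a b hab => ⟨b, .single hab, .refl⟩)

/-- Words to which no rewriting rule applies. -/
def IsReducedWord (R : List G → List G → Prop) (w : List G) : Prop := ∀ s, ¬ MStep R w s

theorem IsReducedWord.of_append {w v : List G} (h : IsReducedWord R (w ++ v)) : IsReducedWord R w := by
  rintro s ⟨a, l, r, b, hR, rfl, rfl⟩
  exact h (a ++ r ++ (b ++ v)) ⟨a, l, r, b ++ v, hR, by simp, by simp⟩

theorem exists_isReducedWord (hnoeth : WellFounded (fun w₁ w₂ : List G => MStep R w₂ w₁))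
    (w : List G) : ∃ u, ReflTransGen (MStep R) w u ∧ IsReducedWord R u := by
  induction w using hnoeth.induction with
  | _ w ih =>
    by_cases h : IsReducedWord R w
    · exact ⟨w, .refl, h⟩
    · simp only [IsReducedWord, not_forall, not_not] at h
      obtain ⟨s, hs⟩ := h
      obtain ⟨u, hu, hred⟩ := ih s hs
      exact ⟨u, .head hs hu, hred⟩

theorem not_rule_nil (hnoeth : WellFounded (fun w₁ w₂ : List G => MStep R w₂ w₁))
    (r : List G) : ¬ R [] r := by
  intro h
  obtain ⟨u, -, hu⟩ := exists_isReducedWord hnoeth ([] : List G)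
  exact hu (r ++ u) ⟨[], [], r, u, h, by simp, by simp⟩

theorem isReducedWord_nil (hnoeth : WellFounded (fun w₁ w₂ : List G => MStep R w₂ w₁)) :
    IsReducedWord R ([] : List G) := by
  rintro s ⟨a, l, r, b, hR, hw, -⟩
  obtain ⟨-, rfl, -⟩ : a = [] ∧ l = [] ∧ b = [] := by simpa using hw.symm
  exact not_rule_nil hnoeth r hR

theorem isReducedWord_singleton (hnoeth : WellFounded (fun w₁ w₂ : List G => MStep R w₂ w₁))
    (hnosingle : ∀ (g : G) (r : List G), ¬ R [g] r) (g : G) : IsReducedWord R [g] := by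
  rintro s ⟨a, l, r, b, hR, hw, -⟩
  have hl : l ≠ [] := by
    rintro rfl
    exact not_rule_nil hnoeth r hR
  have hlen := congrArg List.length hw
  have hpos := List.length_pos_iff.2 hl
  simp only [List.length_append, List.length_singleton] at hlen
  obtain rfl : a = [] := List.length_eq_zero_iff.1 (by lia)
  obtain rfl : b = [] := List.length_eq_zero_iff.1 (by lia)
  obtain rfl : [g] = l := by simpa using hw
  exact hnosingle g r hR

/-- A quantity preserved by the action of last letters is preserved by all reductions that start
from a reduced word. -/
theorem IsReducedWord.eq_of_reflTransGen {Z : Type*} {φ : List G → X → Z}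
    (hφ : ∀ w g x y, act g x = some y → φ (w ++ [g]) x = φ w y) {p t : List G × X}
    (hp : IsReducedWord R p.1) (h : ReflTransGen (PStep R act) p t) :
    φ p.1 p.2 = φ t.1 t.2 := by
  suffices IsReducedWord R t.1 ∧ φ p.1 p.2 = φ t.1 t.2 from this.2
  induction h with
  | refl => exact ⟨hp, rfl⟩
  | @tail b c _ hs ih =>
    rcases hs with ⟨hM, -⟩ | ⟨w, g, y, hw, hact, hc1, hc2⟩
    · exact absurd hM (ih.1 _)
    · rw [hc1, hc2, ih.2, hw]
      exact ⟨(hw ▸ ih.1).of_append, hφ w g _ y hact⟩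

theorem eq_of_reflTransGen_of_forall_not {p t : List G × X}
    (hp : ∀ q, ¬ PStep R act p q) (h : ReflTransGen (PStep R act) p t) : p = t :=
  (reflTransGen_iff_eq hp).1 h |>.symm

theorem IsReducedWord.not_pStep_nil (h : IsReducedWord R []) (x : X) (q : List G × X) :
    ¬ PStep R act ([], x) q := by
  rintro (⟨hM, -⟩ | ⟨w, g, y, hw, -⟩)
  · exact h _ hM
  · simp at hw

theorem IsReducedWord.not_pStep_append_singleton {w : List G} {g : G} (h : IsReducedWord R (w ++ [g]))
    {x : X} (hx : act g x = none) (q : List G × X) : ¬ PStep R act (w ++ [g], x) q := by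
  rintro (⟨hM, -⟩ | ⟨v, k, y, hw, hact, -⟩)
  · exact h _ hM
  · obtain ⟨-, rfl⟩ := List.append_singleton_inj.1 hw
    simp [hx] at hact

theorem isClosed_isSome [TopologicalSpace X]
    (hnoeth : WellFounded (fun w₁ w₂ : List G => MStep R w₂ w₁))
    (hnosingle : ∀ (g : G) (r : List G), ¬ R [g] r)
    (hclosed : ∀ w : List G,
      IsClosed {x : X | ∃ y, ReflTransGen (PStep R act) (w, x) ([], y)}) (g : G) :
    IsClosed {x | (act g x).isSome} := by
  convert hclosed [g] using 1
  ext x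
  constructor
  · intro hx
    obtain ⟨y, hy⟩ := Option.isSome_iff_exists.1 hx
    exact ⟨y, .single (Or.inr ⟨[], g, y, rfl, hy, rfl, rfl⟩)⟩
  · rintro ⟨y, hy⟩
    by_contra hx
    have h := eq_of_reflTransGen_of_forall_not
      (IsReducedWord.not_pStep_append_singleton (w := []) (isReducedWord_singleton hnoeth hnosingle g)
        (by simpa using hx)) hy
    simp at h

theorem PGlob.continuous_iff [TopologicalSpace X] {Z : Type*} [TopologicalSpace Z]
    {F : PGlob R act → Z} :
    Continuous F ↔ ∀ w, Continuous fun x : X => F (PGlob.mk R act (w, x)) := by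
  rw [continuous_iSup_dom]
  exact forall_congr' fun w => continuous_coinduced_dom

theorem PGlob.isClosed_iff [TopologicalSpace X] {A : Set (PGlob R act)} :
    IsClosed A ↔ ∀ w, IsClosed {x : X | PGlob.mk R act (w, x) ∈ A} := by
  rw [isClosed_iSup_iff]
  exact forall_congr' fun w => isClosed_coinduced

theorem PGlob.continuous_mk [TopologicalSpace X] (w : List G) :
    Continuous fun x : X => PGlob.mk R act (w, x) :=
  continuous_iff.1 continuous_id w

/-- If continuous selections of the pullbacks of `C` extend from closed subsets of `X`, then `C`
has a continuous selection on the globalization. -/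
theorem PGlob.exists_continuous_selection [TopologicalSpace X] {Z : Type*} [TopologicalSpace Z]
    [Nonempty Z]
    (hnoeth : WellFounded (fun w₁ w₂ : List G => MStep R w₂ w₁))
    (hconfP : ∀ p q₁ q₂ : List G × X, ReflTransGen (PStep R act) p q₁ →
      ReflTransGen (PStep R act) p q₂ →
      ∃ t, ReflTransGen (PStep R act) q₁ t ∧ ReflTransGen (PStep R act) q₂ t)
    (hcont : ∀ g : G, ContinuousOn (fun x => (act g x).getD x) {x | (act g x).isSome})
    (hdom : ∀ g : G, IsClosed {x | (act g x).isSome})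
    (C : PGlob R act → Set Z)
    (hC : ∀ (w : List G) (D : Set X) (f : X → Z), IsClosed D → ContinuousOn f D →
      (∀ x ∈ D, f x ∈ C (PGlob.mk R act (w, x))) →
      ∃ h : X → Z, Continuous h ∧ EqOn h f D ∧ ∀ x, h x ∈ C (PGlob.mk R act (w, x))) :
    ∃ F : PGlob R act → Z, Continuous F ∧ ∀ y, F y ∈ C y := by
  let Good : List G → (X → Z) → Prop := fun w f =>
    Continuous f ∧ ∀ x, f x ∈ C (PGlob.mk R act (w, x))
  obtain ⟨f₀, hf₀⟩ : ∃ f, Good [] f := by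
    obtain ⟨h, h1, -, h2⟩ := hC [] ∅ (fun _ => Classical.arbitrary Z) isClosed_empty
      (continuousOn_empty _) (by simp)
    exact ⟨h, h1, h2⟩
  have hnext : ∀ g w f, ∃ h : X → Z, Good w f →
      Good (w ++ [g]) h ∧ ∀ x y, act g x = some y → h x = f y := by
    intro g w f
    by_cases hf : Good w f
    · obtain ⟨h, h1, h2, h3⟩ := hC (w ++ [g]) _ (fun x => f ((act g x).getD x)) (hdom g)
        (hf.1.comp_continuousOn (hcont g)) (by
          intro x hx
          obtain ⟨y, hy⟩ := Option.isSome_iff_exists.1 hx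
          rw [mk_append_singleton w hy]
          simpa [hy] using hf.2 y)
      refine ⟨h, fun _ => ⟨⟨h1, h3⟩, fun x y hxy => ?_⟩⟩
      rw [h2 (by simp [hxy] : x ∈ {x | (act g x).isSome})]
      simp [hxy]
    · exact ⟨f, fun h => absurd h hf⟩
  choose next hnext using hnext
  let ψ : List G → X → Z := fun l => List.rec f₀ (fun g l f => next g l.reverse f) l
  have hψ : ∀ l, Good l.reverse (ψ l) := by
    intro l
    induction l with
    | nil => exact hf₀
    | cons g l ih =>
      rw [List.reverse_cons]
      exact (hnext g l.reverse (ψ l) ih).1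
  let φ : List G → X → Z := fun w => ψ w.reverse
  have hφgood : ∀ w, Good w (φ w) := fun w => by simpa using hψ w.reverse
  have hφ : ∀ w g x y, act g x = some y → φ (w ++ [g]) x = φ w y := by
    intro w g x y hxy
    simp only [φ, List.reverse_append, List.reverse_singleton, List.singleton_append]
    exact (hnext g w.reverse.reverse (ψ w.reverse) (hψ _)).2 x y hxy
  choose nf hnf hred using exists_isReducedWord hnoeth
  have hinv : ∀ p q : List G × X, EqvGen (PStep R act) p q →
      φ (nf p.1) p.2 = φ (nf q.1) q.2 := by
    intro p q hpq
    have h : PGlob.mk R act (nf p.1, p.2) = PGlob.mk R act (nf q.1, q.2) := by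
      rw [← mk_eq_of_reflTransGen_mStep (hnf p.1), ← mk_eq_of_reflTransGen_mStep (hnf q.1)]
      exact mk_eq_of_eqvGen hpq
    obtain ⟨t, hpt, hqt⟩ := join_of_mk_eq hconfP h
    exact (IsReducedWord.eq_of_reflTransGen hφ (hred p.1) hpt).trans
      (IsReducedWord.eq_of_reflTransGen hφ (hred q.1) hqt).symm
  refine ⟨Quot.lift (fun p => φ (nf p.1) p.2) hinv,
    continuous_iff.2 fun w => (hφgood (nf w)).1, ?_⟩
  rintro ⟨w, x⟩
  have := (hφgood (nf w)).2 x
  rwa [← mk_eq_of_reflTransGen_mStep (hnf w)] at this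

/-- The canonical map from a closed confluent partial action to its globalization is a closed
embedding. -/
theorem PGlob.isClosedEmbedding_mk_nil [TopologicalSpace X]
    (hnoeth : WellFounded (fun w₁ w₂ : List G => MStep R w₂ w₁))
    (hconfP : ∀ p q₁ q₂ : List G × X, ReflTransGen (PStep R act) p q₁ →
      ReflTransGen (PStep R act) p q₂ →
      ∃ t, ReflTransGen (PStep R act) q₁ t ∧ ReflTransGen (PStep R act) q₂ t)
    (hcont : ∀ g : G, ContinuousOn (fun x => (act g x).getD x) {x | (act g x).isSome})
    (hdom : ∀ g : G, IsClosed {x | (act g x).isSome}) :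
    Topology.IsClosedEmbedding fun x : X => PGlob.mk R act ([], x) := by
  have hnil := IsReducedWord.not_pStep_nil (act := act) (isReducedWord_nil hnoeth)
  have hinj : Function.Injective fun x : X => PGlob.mk R act ([], x) := by
    intro x y hxy
    obtain ⟨t, hxt, hyt⟩ := join_of_mk_eq hconfP hxy
    have h := (eq_of_reflTransGen_of_forall_not (hnil x) hxt).trans
      (eq_of_reflTransGen_of_forall_not (hnil y) hyt).symm
    simpa using h
  refine .of_continuous_injective_isClosedMap (continuous_mk []) hinj fun A hA => ?_
  have hreduced : ∀ u, IsReducedWord R u →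
      IsClosed {x | PGlob.mk R act (u, x) ∈ (fun x : X => PGlob.mk R act ([], x)) '' A} := by
    intro u
    induction u using List.reverseRecOn with
    | nil =>
      intro _
      convert hA using 1
      exact preimage_image_eq A hinj
    | append_singleton w g ih =>
      intro hu
      convert (hcont g).preimage_isClosed_of_isClosed (hdom g) (ih hu.of_append) using 1
      ext x
      cases hx : act g x with
      | some y => simp [hx, mk_append_singleton w hx]
      | none =>
        simp only [mem_image, mem_ofPred_eq, mem_inter_iff, hx, Option.isSome_none,
          Bool.false_eq_true, false_and, iff_false, not_exists, not_and]
        intro a _ ha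
        obtain ⟨t, hat, hxt⟩ := join_of_mk_eq hconfP ha
        have h := (eq_of_reflTransGen_of_forall_not (hnil a) hat).trans
          (eq_of_reflTransGen_of_forall_not (hu.not_pStep_append_singleton hx) hxt).symm
        simp at h
  refine isClosed_iff.2 fun w => ?_
  obtain ⟨u, hwu, hu⟩ := exists_isReducedWord hnoeth w
  simpa only [mk_eq_of_reflTransGen_mStep hwu] using hreduced u hu

end Globalization

/-- Covering dimension is monotone along closed embeddings. -/
theorem CovDimLE.of_isClosedEmbedding {A B : Type*} [TopologicalSpace A] [TopologicalSpace B]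
    {f : A → B} (hf : Topology.IsClosedEmbedding f) {m : ℕ} (h : CovDimLE B m) :
    CovDimLE A m := by
  intro ι hι U hU hcov
  rcases isEmpty_or_nonempty A with hA | ⟨⟨a₀⟩⟩
  · exact ⟨U, hU, fun _ => subset_rfl, hcov, fun a => isEmptyElim a⟩
  obtain ⟨i₀, -⟩ := mem_iUnion.1 (hcov ▸ mem_univ a₀)
  obtain ⟨V, hV, hVU, hVcov, hVord⟩ := h ι hι (fun i => (f '' (U i)ᶜ)ᶜ)
    (fun i => (hf.isClosedMap _ (hU i).isClosed_compl).isOpen_compl) (by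
      refine eq_univ_of_forall fun b => ?_
      by_contra hb
      simp only [mem_iUnion, not_exists, mem_compl_iff, not_not] at hb
      obtain ⟨a, -, rfl⟩ := hb i₀
      obtain ⟨i, hi⟩ := mem_iUnion.1 (hcov ▸ mem_univ a)
      obtain ⟨a', ha', haa'⟩ := hb i
      exact ha' (hf.injective haa' ▸ hi))
  refine ⟨fun i => f ⁻¹' V i, fun i => (hV i).preimage hf.continuous, fun i a ha => ?_,
    ?_, fun a => hVord (f a)⟩
  · by_contra hau
    exact hVU i ha ⟨a, hau, rfl⟩
  · rw [← preimage_iUnion, hVcov, preimage_univ]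

/-- For a closed confluent continuous partial action on a normal space `X` of
covering dimension `n`, the topological globalization `Y` is normal and has
covering dimension `n`. -/
theorem stmt_16 {G X : Type*} [TopologicalSpace X]
    (R : List G → List G → Prop) (act : G → X → Option X)
    (hnoeth : WellFounded (fun w₁ w₂ : List G => MStep R w₂ w₁))
    (hconfM : ∀ w s₁ s₂ : List G, Relation.ReflTransGen (MStep R) w s₁ →
      Relation.ReflTransGen (MStep R) w s₂ →
      ∃ t, Relation.ReflTransGen (MStep R) s₁ t ∧ Relation.ReflTransGen (MStep R) s₂ t)
    (hnosingle : ∀ (g : G) (r : List G), ¬ R [g] r)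
    (hconfP : ∀ p q₁ q₂ : List G × X, Relation.ReflTransGen (PStep R act) p q₁ →
      Relation.ReflTransGen (PStep R act) p q₂ →
      ∃ t, Relation.ReflTransGen (PStep R act) q₁ t ∧
        Relation.ReflTransGen (PStep R act) q₂ t)
    (hcont : ∀ g : G, ContinuousOn (fun x => (act g x).getD x) {x | (act g x).isSome})
    (hclosed : ∀ w : List G,
      IsClosed {x : X | ∃ y, Relation.ReflTransGen (PStep R act) (w, x) ([], y)})
    (hnormal : NormalSpace X) (hT1 : T1Space X)
    (n : ℕ) (hdim : CovDimLE X n) (hdim' : ∀ m : ℕ, CovDimLE X m → n ≤ m) :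
    NormalSpace (PGlob R act) ∧ CovDimLE (PGlob R act) n ∧
      ∀ m : ℕ, CovDimLE (PGlob R act) m → n ≤ m := by
  have hdom := isClosed_isSome hnoeth hnosingle hclosed
  refine ⟨⟨fun A B hA hB hAB => ?_⟩, fun ι hι U hU hcov => ?_, fun m hm => hdim' m
    (hm.of_isClosedEmbedding (PGlob.isClosedEmbedding_mk_nil hnoeth hconfP hcont hdom))⟩
  · obtain ⟨F, hF, hFC⟩ := PGlob.exists_continuous_selection hnoeth hconfP hcont hdom
      (fun y => {z : ℝ | (y ∈ A → z = 0) ∧ (y ∈ B → z = 1)}) (by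
        intro w D f hD hf hfD
        have hA' := PGlob.isClosed_iff.1 hA w
        have hB' := PGlob.isClosed_iff.1 hB w
        obtain ⟨h₁, hh₁, hD₁, hA₁⟩ := exists_continuous_eqOn_eqOn (g := fun _ => 0) hD hA' hf
          continuousOn_const fun x hx => (hfD x hx).1
        obtain ⟨h₂, hh₂, hD₂, hB₂⟩ := exists_continuous_eqOn_eqOn (g := fun _ => 1)
          (hD.union hA') hB' hh₁.continuousOn continuousOn_const (by
            rintro x (hx | hx) hxB
            · exact (hD₁ hx).trans ((hfD x hx).2 hxB)
            · exact (disjoint_left.1 hAB hx hxB).elim)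
        exact ⟨h₂, hh₂, fun x hx => (hD₂ (Or.inl hx)).trans (hD₁ hx), fun x =>
          ⟨fun hx => (hD₂ (Or.inr hx)).trans (hA₁ hx), fun hx => hB₂ hx⟩⟩)
    refine ⟨F ⁻¹' Iio (1 / 2), F ⁻¹' Ioi (1 / 2), isOpen_Iio.preimage hF, isOpen_Ioi.preimage hF,
      fun y hy => ?_, fun y hy => ?_, ?_⟩
    · simp [(hFC y).1 hy]
    · simp only [mem_preimage, (hFC y).2 hy, mem_Ioi]
      norm_num
    · exact Disjoint.preimage F (disjoint_left.2 fun z hz hz' => lt_asymm (mem_Iio.1 hz) (mem_Ioi.1 hz'))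
  · obtain ⟨F, hF, hFC⟩ := PGlob.exists_continuous_selection hnoeth hconfP hcont hdom
      (fun y => {t : ι → ℝ | t ∈ skeletonCone ι n ∧ t ≠ 0 ∧ ∀ i, t i ≠ 0 → y ∈ U i}) (by
        intro w D f hD hf hfD
        exact hdim.exists_extension (U := fun i => {x | PGlob.mk R act (w, x) ∈ U i})
          (fun i => (hU i).preimage (PGlob.continuous_mk w))
          (eq_univ_of_forall fun x => by
            simpa using mem_iUnion.1 (hcov ▸ mem_univ (PGlob.mk R act (w, x)))) hD hf hfD)
    refine ⟨fun i => {y | F y i ≠ 0}, fun i =>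
      isOpen_ne_fun ((continuous_apply i).comp hF) continuous_const, fun i y => (hFC y).2.2 i,
      eq_univ_of_forall fun y => mem_iUnion.2 (Function.ne_iff.1 (hFC y).2.1),
      fun y => (hFC y).1.2⟩
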